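/- arXiv:2507.17935 — 2 statements merged into one kernel-verified Lean document; each statement's English description precedes it below -/
import Mathlib

section
/- Let 0 ⊂ I ⊊ J ⊂ S be two monomial ideals and let I^p ⊊ J^p ⊂ S^p be their polarizations. Then slength(J/I) ≥ slength(J^p/I^p). -/
open MvPolynomial

/-- The set of exponent vectors of the monomials in the Stanley space `x^u · K[Z]`. -/
def stanleySet {σ : Type} (u : σ →₀ ℕ) (Z : Set σ) : Set (σ →₀ ℕ) :=
  {w | ∃ v : σ →₀ ℕ, ↑v.support ⊆ Z ∧ w = u + v}

/-- A Stanley decomposition (partition into Stanley spaces) of a set `P` of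
exponent vectors of monomials.  By the standard correspondence, Stanley
decompositions of a multigraded `K`-vector subquotient of `S` spanned by the
monomials with exponents in `P` correspond exactly to such partitions. -/
structure StanleyPartition {σ : Type} (P : Set (σ →₀ ℕ)) where
  r : ℕ
  base : Fin r → σ →₀ ℕ
  vars : Fin r → Set σ
  cover : P = ⋃ i, stanleySet (base i) (vars i)
  disj : ∀ i j, i ≠ j → Disjoint (stanleySet (base i) (vars i)) (stanleySet (base j) (vars j))

/-- The Stanley length of `P`: the minimal length of a Stanley decomposition. -/
noncomputable def slength {σ : Type} (P : Set (σ →₀ ℕ)) : ℕ :=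
  sInf {r | ∃ D : StanleyPartition P, D.r = r}

/-- The set of exponent vectors of the monomials belonging to an ideal. -/
def monSet {σ K : Type} [Field K] (I : Ideal (MvPolynomial σ K)) : Set (σ →₀ ℕ) :=
  {d | (monomial d (1 : K) : MvPolynomial σ K) ∈ I}

/-- `I` is a monomial ideal. -/
def IsMonomialIdeal {σ K : Type} [Field K] (I : Ideal (MvPolynomial σ K)) : Prop :=
  ∃ A : Set (σ →₀ ℕ), I = Ideal.span ((fun d => (monomial d (1 : K) : MvPolynomial σ K)) '' A)

/-- Exponent vectors of the minimal monomial generators of `I`. -/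
def minGens {σ K : Type} [Field K] (I : Ideal (MvPolynomial σ K)) : Set (σ →₀ ℕ) :=
  {d | d ∈ monSet I ∧ ∀ e ∈ monSet I, e ≤ d → e = d}

/-- Polarization of an exponent vector: the squarefree exponent vector in the
variables `x_{jk}`, `j ∈ Fin n`, `k ∈ Fin N`, given by `∏_j ∏_{k < d j} x_{jk}`. -/
noncomputable def polarize {n N : ℕ} (d : Fin n →₀ ℕ) : (Fin n × Fin N) →₀ ℕ :=
  Finsupp.equivFunOnFinite.symm (fun p => if p.2.val < d p.1 then 1 else 0)

/-- The polarization of a monomial ideal `I`: the squarefree monomial ideal of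
`S^p = K[x_{jk}]` generated by the polarizations of the minimal monomial
generators of `I`. -/
noncomputable def polarizationIdeal {K : Type} [Field K] {n : ℕ} (N : ℕ)
    (I : Ideal (MvPolynomial (Fin n) K)) : Ideal (MvPolynomial (Fin n × Fin N) K) :=
  Ideal.span ((fun d => (monomial (polarize (N := N) d) (1 : K) :
    MvPolynomial (Fin n × Fin N) K)) '' minGens I)

theorem mem_stanleySet_iff {σ : Type} {u w : σ →₀ ℕ} {Z : Set σ} :
    w ∈ stanleySet u Z ↔ u ≤ w ∧ ∀ j, j ∉ Z → w j = u j := by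
  constructor
  · rintro ⟨v, hv, rfl⟩
    refine ⟨le_self_add, fun j hj => ?_⟩
    have : v j = 0 := by
      by_contra h
      exact hj (hv (by simpa using h))
    simp [this]
  · rintro ⟨hle, h⟩
    refine ⟨w - u, fun j hj => ?_, (add_tsub_cancel_of_le hle).symm⟩
    by_contra hjZ
    simp [h j hjZ] at hj

/-- A partition into Stanley spaces indexed by a finite type is a Stanley decomposition. -/
theorem exists_stanleyPartition {σ ι : Type} [Finite ι] {P : Set (σ →₀ ℕ)}
    (b : ι → σ →₀ ℕ) (V : ι → Set σ) (cover : P = ⋃ i, stanleySet (b i) (V i))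
    (disj : ∀ i j, i ≠ j → Disjoint (stanleySet (b i) (V i)) (stanleySet (b j) (V j))) :
    ∃ D : StanleyPartition P, D.r = Nat.card ι := by
  let e := Finite.equivFin ι
  refine ⟨⟨Nat.card ι, b ∘ e.symm, V ∘ e.symm, ?_, fun i j hij => ?_⟩, rfl⟩
  · rw [cover]
    exact (e.symm.surjective.iUnion_comp fun i => stanleySet (b i) (V i)).symm
  · exact disj _ _ (e.symm.injective.ne hij)

/-- A set of exponent vectors that only depends on the truncations at `N` has a Stanley
decomposition. -/
theorem exists_stanleyPartition_of_truncation {n N : ℕ} {P : Set (Fin n →₀ ℕ)}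
    (hP : ∀ w w' : Fin n →₀ ℕ, (∀ j, min (w j) N = min (w' j) N) → w ∈ P → w' ∈ P) :
    Nonempty (StanleyPartition P) := by
  let f (c : Fin n → Fin (N + 1)) : Fin n →₀ ℕ :=
    Finsupp.equivFunOnFinite.symm fun j => (c j).val
  have key : ∀ (c : Fin n → Fin (N + 1)) (w : Fin n →₀ ℕ),
      w ∈ stanleySet (f c) {j | (c j).val = N} ↔ ∀ j, min (w j) N = (c j).val := by
    intro c w
    rw [mem_stanleySet_iff, Finsupp.le_def, ← forall_and]
    refine forall_congr' fun j => ?_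
    have := (c j).isLt
    simp only [f, Finsupp.equivFunOnFinite_symm_apply_apply, Set.mem_ofPred_eq]
    omega
  refine (exists_stanleyPartition (ι := {c : Fin n → Fin (N + 1) // f c ∈ P})
    (P := P) (fun c => f c.1) (fun c => {j | (c.1 j).val = N}) ?_ ?_).nonempty
  · ext w
    simp only [Set.mem_iUnion, key, Subtype.exists, exists_prop]
    constructor
    · intro hw
      refine ⟨fun j => ⟨min (w j) N, by omega⟩, hP w _ (fun j => ?_) hw, fun j => rfl⟩
      simp [f]
    · rintro ⟨c, hc, h⟩
      refine hP _ w (fun j => ?_) hc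
      have := (c j).isLt
      rw [h]
      simp only [f, Finsupp.equivFunOnFinite_symm_apply_apply]
      omega
  · intro c c' hne
    rw [Set.disjoint_left]
    intro w hw hw'
    rw [key] at hw hw'
    exact hne (Subtype.ext (funext fun j => Fin.ext ((hw j).symm.trans (hw' j))))

/-- The exponent vector whose `j`-th entry is the length of the longest initial segment of
`x_{j,0}, x_{j,1}, …` dividing `x^w`. -/
noncomputable def depolarize {n N : ℕ} (w : (Fin n × Fin N) →₀ ℕ) : Fin n →₀ ℕ :=
  open Classical in
  Finsupp.equivFunOnFinite.symm fun j =>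
    Nat.findGreatest (fun k => ∀ i : Fin N, i.val < k → w (j, i) ≠ 0) N

theorem depolarize_le {n N : ℕ} (w : (Fin n × Fin N) →₀ ℕ) (j : Fin n) :
    depolarize w j ≤ N := by
  classical
  exact Nat.findGreatest_le N

theorem le_depolarize_iff {n N : ℕ} {w : (Fin n × Fin N) →₀ ℕ} {j : Fin n} {k : ℕ}
    (hk : k ≤ N) : k ≤ depolarize w j ↔ ∀ i : Fin N, i.val < k → w (j, i) ≠ 0 := by
  classical
  constructor
  · intro h i hi
    exact Nat.findGreatest_spec (P := fun k => ∀ i : Fin N, i.val < k → w (j, i) ≠ 0)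
      (Nat.zero_le N) (by simp) i (hi.trans_le h)
  · exact fun h => Nat.le_findGreatest hk h

theorem polarize_le_iff {n N : ℕ} {d : Fin n →₀ ℕ} {w : (Fin n × Fin N) →₀ ℕ}
    (hd : ∀ j, d j ≤ N) : polarize d ≤ w ↔ d ≤ depolarize w := by
  simp only [Finsupp.le_def, le_depolarize_iff (hd _), Prod.forall]
  refine forall_congr' fun j => forall_congr' fun i => ?_
  simp only [polarize, Finsupp.equivFunOnFinite_symm_apply_apply]
  split_ifs with h <;> simp [h, Nat.one_le_iff_ne_zero]

/-- The preimage of a Stanley space under `depolarize` is a Stanley space. -/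
theorem depolarize_mem_stanleySet_iff {n N : ℕ} {u : Fin n →₀ ℕ} {Z : Set (Fin n)}
    (hu : ∀ j, u j ≤ N) {w : (Fin n × Fin N) →₀ ℕ} :
    depolarize w ∈ stanleySet u Z ↔
      w ∈ stanleySet (polarize u) {p | p.1 ∉ Z → p.2.val ≠ u p.1} := by
  rw [mem_stanleySet_iff, mem_stanleySet_iff, polarize_le_iff hu]
  refine and_congr_right fun hle => ?_
  simp only [Set.mem_ofPred_eq, Prod.forall, Classical.not_imp, not_not, and_imp]
  refine forall_congr' fun j => ?_
  have hj := hle j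
  have hN := depolarize_le w j
  constructor
  · intro h i hjZ hi
    have hlt : ¬ (u j + 1 ≤ depolarize w j) := by have := h hjZ; omega
    rw [le_depolarize_iff (by omega)] at hlt
    push Not at hlt
    obtain ⟨i', hi', h0⟩ := hlt
    have hge : ¬ i'.val < u j := fun hc => (le_depolarize_iff (hu j)).1 hj i' hc h0
    obtain rfl : i' = i := Fin.ext (by omega)
    simp [h0, polarize, hi]
  · intro h hjZ
    by_contra hne
    have hlt : u j + 1 ≤ depolarize w j := by omega
    refine (le_depolarize_iff (by omega)).1 hlt ⟨u j, by omega⟩ (by simp) ?_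
    rw [h _ hjZ rfl]
    simp [polarize]

theorem mem_monSet_iff {n : ℕ} {K : Type} [Field K] {I : Ideal (MvPolynomial (Fin n) K)}
    {w : Fin n →₀ ℕ} : w ∈ monSet I ↔ ∃ d ∈ minGens I, d ≤ w := by
  constructor
  · intro hw
    obtain ⟨d, hdw, hd⟩ := exists_minimal_le_of_wellFoundedLT (· ∈ monSet I) w hw
    exact ⟨d, ⟨hd.prop, fun e he hed => hd.eq_of_le he hed⟩, hdw⟩
  · rintro ⟨d, hd, hdw⟩
    have h := I.mul_mem_left (monomial (w - d) 1) hd.1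
    rwa [monomial_mul, one_mul, tsub_add_cancel_of_le hdw] at h

theorem mem_monSet_polarizationIdeal_iff {n N : ℕ} {K : Type} [Field K]
    {I : Ideal (MvPolynomial (Fin n) K)} (hN : ∀ d ∈ minGens I, ∀ j, d j ≤ N)
    {w : (Fin n × Fin N) →₀ ℕ} :
    w ∈ monSet (polarizationIdeal N I) ↔ depolarize w ∈ monSet I := by
  have himage : (fun d => (monomial (polarize (N := N) d) (1 : K) :
      MvPolynomial (Fin n × Fin N) K)) '' minGens I =
      (fun s => monomial s 1) '' (polarize '' minGens I) := by
    rw [Set.image_image]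
  rw [mem_monSet_iff, monSet, Set.mem_ofPred_eq, polarizationIdeal, himage,
    mem_ideal_span_monomial_image]
  classical
  simp only [support_monomial, one_ne_zero, if_false, Finset.mem_singleton, forall_eq,
    Set.exists_mem_image]
  exact exists_congr fun d => and_congr_right fun hd => polarize_le_iff (hN d hd)

theorem mem_monSet_of_min_eq {n N : ℕ} {K : Type} [Field K]
    {I : Ideal (MvPolynomial (Fin n) K)} (hN : ∀ d ∈ minGens I, ∀ j, d j ≤ N)
    {w w' : Fin n →₀ ℕ} (h : ∀ j, min (w j) N = min (w' j) N) (hw : w ∈ monSet I) :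
    w' ∈ monSet I := by
  obtain ⟨d, hd, hdw⟩ := mem_monSet_iff.1 hw
  refine mem_monSet_iff.2 ⟨d, hd, fun j => ?_⟩
  have h₁ := h j
  have h₂ := hN d hd j
  have h₃ := hdw j
  omega

/-- A Stanley decomposition pulls back along `depolarize` to one that is no longer. -/
theorem exists_stanleyPartition_preimage {n N : ℕ} {P : Set (Fin n →₀ ℕ)}
    (D : StanleyPartition P) :
    ∃ E : StanleyPartition (depolarize (N := N) ⁻¹' P), E.r ≤ D.r := by
  have hcard : Nat.card {i : Fin D.r // ∀ j, D.base i j ≤ N} ≤ D.r := by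
    simpa using Finite.card_subtype_le (fun i : Fin D.r => ∀ j, D.base i j ≤ N)
  refine (exists_stanleyPartition (ι := {i : Fin D.r // ∀ j, D.base i j ≤ N})
    (P := depolarize (N := N) ⁻¹' P) (fun i => polarize (D.base i))
    (fun i => {p | p.1 ∉ D.vars i → p.2.val ≠ D.base i p.1}) ?_ ?_).imp
    fun E hE => hE.trans_le hcard
  · ext w
    have hcover : depolarize w ∈ P ↔ depolarize w ∈ ⋃ i, stanleySet (D.base i) (D.vars i) :=
      iff_of_eq (congrArg (depolarize w ∈ ·) D.cover)
    rw [Set.mem_preimage, hcover, Set.mem_iUnion, Set.mem_iUnion]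
    constructor
    · rintro ⟨i, hi⟩
      have hu : ∀ j, D.base i j ≤ N := fun j =>
        ((mem_stanleySet_iff.1 hi).1 j).trans (depolarize_le w j)
      exact ⟨⟨i, hu⟩, (depolarize_mem_stanleySet_iff hu).1 hi⟩
    · rintro ⟨i, hi⟩
      exact ⟨i.1, (depolarize_mem_stanleySet_iff i.2).2 hi⟩
  · intro i j hij
    rw [Set.disjoint_left]
    intro w hi hj
    exact Set.disjoint_left.1 (D.disj i.1 j.1 (Subtype.coe_injective.ne hij))
      ((depolarize_mem_stanleySet_iff i.2).2 hi) ((depolarize_mem_stanleySet_iff j.2).2 hj)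

/-- If `0 ⊂ I ⊊ J` are monomial ideals and `I^p ⊊ J^p` their
polarizations (inside a polynomial ring `S^p` with enough variables), then
`slength(J/I) ≥ slength(J^p/I^p)`. -/
theorem stmt_11 {K : Type} [Field K] {n N : ℕ} (I J : Ideal (MvPolynomial (Fin n) K))
    (hmonI : IsMonomialIdeal I) (hmonJ : IsMonomialIdeal J)
    (hI : I ≠ ⊥) (hIJ : I < J)
    (hNI : ∀ d ∈ minGens I, ∀ j, d j ≤ N) (hNJ : ∀ d ∈ minGens J, ∀ j, d j ≤ N) :
    slength (monSet J \ monSet I) ≥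
      slength (monSet (polarizationIdeal N J) \ monSet (polarizationIdeal N I)) := by
  have hpre : monSet (polarizationIdeal N J) \ monSet (polarizationIdeal N I) =
      depolarize ⁻¹' (monSet J \ monSet I) := by
    ext w
    simp only [Set.mem_sdiff, Set.mem_preimage, mem_monSet_polarizationIdeal_iff hNI,
      mem_monSet_polarizationIdeal_iff hNJ]
  obtain ⟨D₀⟩ := exists_stanleyPartition_of_truncation (N := N) (P := monSet J \ monSet I)
    fun w w' h hw => ⟨mem_monSet_of_min_eq hNJ h hw.1,
      fun hw' => hw.2 (mem_monSet_of_min_eq hNI (fun j => (h j).symm) hw')⟩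
  obtain ⟨D, hD⟩ := Nat.sInf_mem (s := {r | ∃ D : StanleyPartition (monSet J \ monSet I), D.r = r})
    ⟨D₀.r, D₀, rfl⟩
  obtain ⟨E, hE⟩ := exists_stanleyPartition_preimage (N := N) D
  rw [ge_iff_le, hpre]
  calc slength (depolarize ⁻¹' (monSet J \ monSet I)) ≤ E.r := Nat.sInf_le ⟨E, rfl⟩
    _ ≤ D.r := hE
    _ = slength (monSet J \ monSet I) := hD
end

section
/- Let 0 ⊂ I ⊊ J ⊂ S be two monomial ideals. Then slength(J/I) ≥ slength(√J/√I), where √I and √J denote the radicals of I and J. -/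
open MvPolynomial

/-- The preimage of a Stanley space under multiplication of exponents by `N ≥ 1` is empty or a
Stanley space. -/
theorem preimage_smul_stanleySet {σ : Type} [Finite σ] {N : ℕ} (hN : 0 < N) (u : σ →₀ ℕ)
    (Z : Set σ) (hne : ((fun w : σ →₀ ℕ => N • w) ⁻¹' stanleySet u Z).Nonempty) :
    ∃ u' : σ →₀ ℕ, (fun w : σ →₀ ℕ => N • w) ⁻¹' stanleySet u Z = stanleySet u' Z := by
  classical
  obtain ⟨w₀, v₀, hv₀, hw₀⟩ := hne
  have hmem (a b : σ →₀ ℕ) : b ∈ stanleySet a Z ↔ ∀ i, a i ≤ b i ∧ (i ∉ Z → a i = b i) := by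
    constructor
    · rintro ⟨v, hv, rfl⟩ i
      refine ⟨by simp, fun hi => ?_⟩
      have : v i = 0 := by
        by_contra h
        exact hi (hv (by simpa using h))
      simp [this]
    · intro h
      refine ⟨b - a, fun i hi => ?_, ?_⟩
      · by_contra hZ
        have := (h i).2 hZ
        simp [this] at hi
      · ext i
        have := (h i).1
        simp only [Finsupp.add_apply, Finsupp.tsub_apply]
        omega
  have hw : ∀ i, i ∉ Z → u i = N * w₀ i := fun i hi => by
    simpa using ((hmem u (N • w₀)).1 ⟨v₀, hv₀, hw₀⟩ i).2 hi
  refine ⟨Finsupp.equivFunOnFinite.symm fun i => (u i + (N - 1)) / N, ?_⟩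
  ext w
  rw [Set.mem_preimage, hmem, hmem]
  refine forall_congr' fun i => ?_
  simp only [Finsupp.smul_apply, smul_eq_mul, Finsupp.equivFunOnFinite_symm_apply_apply]
  refine and_congr ?_ ?_
  · rw [← Nat.lt_succ_iff (n := w i), Nat.div_lt_iff_lt_mul hN, Nat.succ_mul, mul_comm (w i)]
    omega
  · refine imp_congr_right fun hi => ?_
    rw [hw i hi]
    have : (N * w₀ i + (N - 1)) / N = w₀ i := by
      rw [Nat.mul_add_div hN, Nat.div_eq_of_lt (by omega), add_zero]
    rw [this]
    exact Nat.mul_right_inj hN.ne'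

/-- A finite family of disjoint sets, each empty or a Stanley space, yields a Stanley
decomposition of its union. -/
theorem exists_stanleyPartition_of_iUnion {σ ι : Type} [Fintype ι] {P : Set (σ →₀ ℕ)}
    (T : ι → Set (σ →₀ ℕ)) (hT : ∀ i, (T i).Nonempty → ∃ u Z, T i = stanleySet u Z)
    (hcover : P = ⋃ i, T i) (hdisj : ∀ i j, i ≠ j → Disjoint (T i) (T j)) :
    ∃ D : StanleyPartition P, D.r ≤ Fintype.card ι := by
  classical
  choose u Z huZ using fun i : {i // (T i).Nonempty} => hT i i.2
  let e := (Fintype.equivFin {i // (T i).Nonempty}).symm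
  refine ⟨⟨Fintype.card {i // (T i).Nonempty}, u ∘ e, Z ∘ e, ?_, ?_⟩,
    Fintype.card_subtype_le _⟩
  · rw [hcover]
    ext w
    simp only [Set.mem_iUnion, Function.comp_apply, ← huZ]
    constructor
    · rintro ⟨i, hi⟩
      exact ⟨e.symm ⟨i, w, hi⟩, by simpa using hi⟩
    · rintro ⟨i, hi⟩
      exact ⟨_, hi⟩
  · intro i j hij
    simp only [Function.comp_apply, ← huZ]
    exact hdisj _ _ fun h => hij (e.injective (Subtype.ext h))

/-- Membership in an upper set of exponents is detected after truncating at a large enough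
bound. -/
theorem exists_forall_inf_mem_of_isUpperSet {σ : Type} [Finite σ] {U : Set (σ →₀ ℕ)}
    (hU : IsUpperSet U) :
    ∃ B : ℕ, ∀ C, B ≤ C → ∀ d : σ →₀ ℕ,
      d ⊓ Finsupp.equivFunOnFinite.symm (fun _ => C) ∈ U ↔ d ∈ U := by
  classical
  have := Fintype.ofFinite σ
  have hfin : {d | Minimal (· ∈ U) d}.Finite :=
    WellQuasiOrderedLE.finite_of_isAntichain (setOfPred_minimal_antichain _)
  refine ⟨∑ d ∈ hfin.toFinset, ∑ i, d i, fun C hC d => ⟨fun h => hU inf_le_left h, fun h => ?_⟩⟩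
  obtain ⟨m, hmd, hm⟩ := exists_minimal_le_of_wellFoundedLT (· ∈ U) d h
  refine hU (le_inf hmd fun i => ?_) hm.prop
  calc m i ≤ ∑ i, m i := Finset.single_le_sum (f := fun i => m i) (by simp) (Finset.mem_univ i)
    _ ≤ ∑ d ∈ hfin.toFinset, ∑ i, d i :=
      Finset.single_le_sum (f := fun d : σ →₀ ℕ => ∑ i, d i) (by simp) (by simpa using hm)
    _ ≤ C := hC

/-- A difference of two upper sets of exponents has a Stanley decomposition. -/
theorem nonempty_stanleyPartition_diff {σ : Type} [Finite σ] {U V : Set (σ →₀ ℕ)}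
    (hU : IsUpperSet U) (hV : IsUpperSet V) : Nonempty (StanleyPartition (U \ V)) := by
  classical
  obtain ⟨B₁, h₁⟩ := exists_forall_inf_mem_of_isUpperSet hU
  obtain ⟨B₂, h₂⟩ := exists_forall_inf_mem_of_isUpperSet hV
  let c : σ →₀ ℕ := Finsupp.equivFunOnFinite.symm fun _ => max B₁ B₂
  have hUc : ∀ d, d ⊓ c ∈ U ↔ d ∈ U := h₁ _ (le_max_left _ _)
  have hVc : ∀ d, d ⊓ c ∈ V ↔ d ∈ V := h₂ _ (le_max_right _ _)
  have : Fintype {a : σ →₀ ℕ // a ≤ c ∧ a ∈ U \ V} :=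
    ((Set.finite_Iic c).subset fun a ha => ha.1 : {a | a ≤ c ∧ a ∈ U \ V}.Finite).fintype
  refine (exists_stanleyPartition_of_iUnion (P := U \ V)
    (fun a : {a : σ →₀ ℕ // a ≤ c ∧ a ∈ U \ V} => {w | w ⊓ c = a}) ?_ ?_ ?_).elim
    fun D _ => ⟨D⟩
  · rintro ⟨a, hac, -⟩ -
    refine ⟨a, {i | a i = c i}, ?_⟩
    ext w
    simp only [Set.mem_ofPred_eq, stanleySet]
    constructor
    · rintro rfl
      refine ⟨w - w ⊓ c, fun i hi => ?_, ?_⟩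
      · simp only [Finset.mem_coe, Finsupp.mem_support_iff, Finsupp.tsub_apply,
          Finsupp.inf_apply] at hi
        simp only [Set.mem_ofPred_eq, Finsupp.inf_apply]
        omega
      · exact (add_tsub_cancel_of_le inf_le_left).symm
    · rintro ⟨v, hv, rfl⟩
      ext i
      have hi := hac i
      by_cases h : v i = 0
      · simpa [h] using hi
      · have : a i = c i := hv (by simpa using h)
        simp [this]
  · ext w
    simp only [Set.mem_iUnion, Set.mem_ofPred_eq]
    constructor
    · rintro ⟨h, h'⟩
      exact ⟨⟨w ⊓ c, inf_le_right, (hUc w).2 h, fun h'' => h' ((hVc w).1 h'')⟩, rfl⟩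
    · rintro ⟨⟨a, ha, haU, haV⟩, rfl⟩
      exact ⟨(hUc w).1 haU, fun h => haV ((hVc w).2 h)⟩
  · intro a b hab
    rw [Set.disjoint_left]
    intro w (hwa : w ⊓ c = a) (hwb : w ⊓ c = b)
    exact hab (Subtype.ext (hwa.symm.trans hwb))

theorem slength_le {σ : Type} {P : Set (σ →₀ ℕ)} (D : StanleyPartition P) : slength P ≤ D.r :=
  Nat.sInf_le ⟨D, rfl⟩

theorem exists_stanleyPartition_r_eq_slength {σ : Type} {P : Set (σ →₀ ℕ)}
    (h : Nonempty (StanleyPartition P)) : ∃ D : StanleyPartition P, D.r = slength P :=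
  Nat.sInf_mem (s := {r | ∃ D : StanleyPartition P, D.r = r}) (h.elim fun D => ⟨D.r, D, rfl⟩)

/-- Taking the preimage under multiplication of exponents by `N ≥ 1` does not increase the
Stanley length. -/
theorem slength_preimage_smul_le {σ : Type} [Finite σ] {N : ℕ} (hN : 0 < N) {P : Set (σ →₀ ℕ)}
    (h : Nonempty (StanleyPartition P)) :
    slength ((fun w : σ →₀ ℕ => N • w) ⁻¹' P) ≤ slength P := by
  obtain ⟨D, hD⟩ := exists_stanleyPartition_r_eq_slength h
  obtain ⟨D', hD'⟩ := exists_stanleyPartition_of_iUnion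
    (P := (fun w : σ →₀ ℕ => N • w) ⁻¹' P)
    (fun i => (fun w : σ →₀ ℕ => N • w) ⁻¹' stanleySet (D.base i) (D.vars i))
    (fun i hi => (preimage_smul_stanleySet hN _ _ hi).imp fun _ hu => ⟨_, hu⟩)
    (by rw [← Set.preimage_iUnion, ← D.cover])
    (fun i j hij => (D.disj i j hij).preimage _)
  rw [Fintype.card_fin] at hD'
  exact (slength_le D').trans (hD'.trans hD.le)

theorem isUpperSet_monSet {σ K : Type} [Field K] (I : Ideal (MvPolynomial σ K)) :
    IsUpperSet (monSet I) := by
  intro a b hab ha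
  have : (monomial b (1 : K) : MvPolynomial σ K) = monomial (b - a) 1 * monomial a 1 := by
    rw [monomial_mul, tsub_add_cancel_of_le hab, one_mul]
  simpa only [monSet, Set.mem_ofPred_eq, this] using I.mul_mem_left _ ha

/-- For all large `N`, a monomial lies in `√I` exactly when its `N`-th power lies in `I`. -/
theorem exists_forall_smul_mem_monSet_iff {σ K : Type} [Finite σ] [Field K]
    (I : Ideal (MvPolynomial σ K)) :
    ∃ k : ℕ, ∀ N, k ≤ N → ∀ w, N • w ∈ monSet I ↔ w ∈ monSet I.radical := by
  obtain ⟨k, hk⟩ := I.exists_radical_pow_le_of_fg (IsNoetherian.noetherian _)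
  refine ⟨k, fun N hN w => ?_⟩
  have hpow : (monomial (N • w) (1 : K) : MvPolynomial σ K) = monomial w 1 ^ N := by
    rw [monomial_pow, one_pow]
  simp only [monSet, Set.mem_ofPred_eq, hpow]
  exact ⟨fun h => ⟨N, h⟩, fun h => hk (Ideal.pow_le_pow_right hN (Ideal.pow_mem_pow h N))⟩

/-- If `0 ⊂ I ⊊ J` are monomial ideals, then
`slength(J/I) ≥ slength(√J/√I)`. -/
theorem stmt_12 {K : Type} [Field K] {n : ℕ} (I J : Ideal (MvPolynomial (Fin n) K))
    (hmonI : IsMonomialIdeal I) (hmonJ : IsMonomialIdeal J)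
    (hI : I ≠ ⊥) (hIJ : I < J) :
    slength (monSet J \ monSet I) ≥ slength (monSet J.radical \ monSet I.radical) := by
  obtain ⟨k₁, h₁⟩ := exists_forall_smul_mem_monSet_iff I
  obtain ⟨k₂, h₂⟩ := exists_forall_smul_mem_monSet_iff J
  let N := k₁ + k₂ + 1
  have hpre : monSet J.radical \ monSet I.radical =
      (fun w : Fin n →₀ ℕ => N • w) ⁻¹' (monSet J \ monSet I) := by
    ext w
    rw [Set.mem_preimage, Set.mem_sdiff, Set.mem_sdiff, h₁ N (by omega), h₂ N (by omega)]
  rw [hpre]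
  exact slength_preimage_smul_le (by omega)
    (nonempty_stanleyPartition_diff (isUpperSet_monSet J) (isUpperSet_monSet I))
end
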